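/- Let k ≥ 0 and let y satisfy 2^k ≤ y < 2^{k+1}, with y not a Zumkeller number. If (x,z) ∈ Ulam[y], then x+z ≥ 2^{k+1}−1. Equivalently: if there exists (x,z) ∈ Ulam[y] with x+z < 2^{k+1}−1, then y is a Zumkeller number. -/

import Mathlib

/-- Fuel-indexed Ulam predicate: a binary word (as a `List Bool`) of length 1 is Ulam,
and a longer word is Ulam iff it is expressible *uniquely* as a concatenation of two
distinct (nonempty) Ulam words. The fuel strictly exceeds the lengths needed. -/
def ulamAux : ℕ → List Bool → Prop
  | 0, _ => False
  | n + 1, w =>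
    if w.length = 1 then True
    else ∃! p : List Bool × List Bool,
      p.1 ≠ [] ∧ p.2 ≠ [] ∧ p.1 ≠ p.2 ∧ w = p.1 ++ p.2 ∧
        ulamAux n p.1 ∧ ulamAux n p.2

/-- A binary word is an Ulam word. -/
def IsUlam (w : List Bool) : Prop := ulamAux w.length w

/-- The word `0^x 1 0^y`. -/
def wordTwo (x y : ℕ) : List Bool :=
  List.replicate x false ++ [true] ++ List.replicate y false

/-- The word `0^x 1 0^y 1 0^z`. -/
def wordThree (x y z : ℕ) : List Bool :=
  List.replicate x false ++ [true] ++ List.replicate y false ++ [true] ++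
    List.replicate z false

/-- `UlamSet y` is the set of pairs `(x,z)` such that `0^x 1 0^y 1 0^z` is Ulam. -/
def UlamSet (y : ℕ) : Set (ℕ × ℕ) := {p | IsUlam (wordThree p.1 y p.2)}

/-- `culam y x z = min(2, N)` where `N` counts `0 ≤ a ≤ y` with both
`w(x,a)` and `w(y-a,z)` Ulam. -/
noncomputable def culam (y x z : ℕ) : ℕ :=
  min 2 {a : ℕ | a ≤ y ∧ IsUlam (wordTwo x a) ∧ IsUlam (wordTwo (y - a) z)}.ncard

/-- A positive integer is Zumkeller if its binary representation has at most one `0`. -/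
def IsZumkeller (y : ℕ) : Prop := 0 < y ∧ (Nat.bits y).count false ≤ 1

/-- The largest `e ≤ d - 1` with `x mod 2^(e+1) < 2^e` and `z mod 2^(e+1) < 2^e`
(and `0` if none exists). -/
def eIdx (d x z : ℕ) : ℕ :=
  Nat.findGreatest (fun e => x % 2 ^ (e + 1) < 2 ^ e ∧ z % 2 ^ (e + 1) < 2 ^ e) (d - 1)

/-- The universal pattern `E1[d]` on `B_d`. -/
def E1 (d x z : ℕ) : ℕ :=
  if 2 ^ d - 1 ≤ x + z then 0
  else if x % 2 ^ eIdx d x z + z % 2 ^ eIdx d x z < 2 ^ eIdx d x z - 1 then 2 else 1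

/-- The universal pattern `E2[d]` on `B_d` (constant `1`). -/
def E2 (_d _x _z : ℕ) : ℕ := 1

/-- The universal pattern `O1[d]` on `B_d`. -/
def O1 (d x z : ℕ) : ℕ :=
  if 2 ^ d - 2 ≤ x + z then 0
  else if (x + z) % 2 = 0 then (if x % 2 = 1 then 0 else 2)
  else if x % 2 ^ eIdx d x z + z % 2 ^ eIdx d x z < 2 ^ eIdx d x z - 1 then 2 else 1

/-- The universal pattern `O2[d]` on `B_d` (independent of `d`). -/
def O2 (_d x z : ℕ) : ℕ :=
  if (x + z) % 2 = 0 then (if x % 2 = 1 then 0 else 2) else 1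

theorem land_two_mul_add (x y p q : ℕ) (hp : p < 2) (hq : q < 2) :
    (2 * x + p) &&& (2 * y + q) = 0 ↔ x &&& y = 0 ∧ p * q = 0 := by
  have h : (2 * x + p) &&& (2 * y + q) = 2 * (x &&& y) + p * q := by
    have h1 := Nat.and_div_two (a := 2 * x + p) (b := 2 * y + q)
    have h2 : ((2 * x + p) &&& (2 * y + q)) % 2 = p * q := by
      have h0 := Nat.and_mod_two_pow (a := 2 * x + p) (b := 2 * y + q) (n := 1)
      rw [pow_one] at h0
      rw [h0]
      interval_cases p <;> interval_cases q <;> simp [Nat.add_mod]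
    have h3 : (2 * x + p) / 2 = x := by omega
    have h4 : (2 * y + q) / 2 = y := by omega
    rw [h3, h4] at h1
    omega
  rw [h]; omega

theorem land_succ_succ (n x y : ℕ) (hn : x + y ≤ n) :
    ((x + 1) &&& (y + 1) = 0) ↔ ¬ (x &&& (y + 1) = 0 ↔ (x + 1) &&& y = 0) := by
  induction n using Nat.strong_induction_on generalizing x y with
  | _ n ih =>
    obtain ⟨a, rfl | rfl⟩ := Nat.even_or_odd' x <;> obtain ⟨b, rfl | rfl⟩ := Nat.even_or_odd' y
    · have h1 := land_two_mul_add a b 1 1 (by simp) (by simp)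
      have h2 := land_two_mul_add a b 0 1 (by simp) (by simp)
      have h3 := land_two_mul_add a b 1 0 (by simp) (by simp)
      simp_all
    · have h1 := land_two_mul_add a (b + 1) 1 0 (by simp) (by simp)
      have h2 := land_two_mul_add a (b + 1) 0 0 (by simp) (by simp)
      have h3 := land_two_mul_add a b 1 1 (by simp) (by simp)
      simp_all [mul_add, add_assoc]
    · have h1 := land_two_mul_add (a + 1) b 0 1 (by simp) (by simp)
      have h2 := land_two_mul_add (a + 1) b 0 0 (by simp) (by simp)
      have h3 := land_two_mul_add a b 1 1 (by simp) (by simp)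
      simp_all [mul_add, add_assoc]
    · have h1 := land_two_mul_add (a + 1) (b + 1) 0 0 (by simp) (by simp)
      have h2 := land_two_mul_add (a + 1) b 0 1 (by simp) (by simp)
      have h3 := land_two_mul_add a (b + 1) 1 0 (by simp) (by simp)
      have h4 := ih (a + b) (by omega) a b le_rfl
      simp_all [mul_add, add_assoc]

theorem add_two_pow_eq_lor {a d : ℕ} (ha : a < 2 ^ d) : a + 2 ^ d = 2 ^ d ||| a := by
  simpa [Nat.add_comm] using Nat.two_pow_add_eq_or_of_lt ha 1

theorem land_add_two_pow {a d x : ℕ} (ha : a < 2 ^ d) (h : (a + 2 ^ d) &&& x = 0) :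
    a &&& x = 0 := by
  rw [add_two_pow_eq_lor ha, Nat.and_or_distrib_right] at h
  simp only [Nat.or_eq_zero_iff] at h
  exact h.2

theorem land_add_two_pow_iff {a d x : ℕ} (ha : a < 2 ^ d) (hx : x < 2 ^ d) :
    (a + 2 ^ d) &&& x = 0 ↔ a &&& x = 0 := by
  rw [add_two_pow_eq_lor ha, Nat.and_or_distrib_right]
  simp [Nat.two_pow_and, Nat.testBit_lt_two_pow hx]

theorem land_add_two_pow_iff' {a d x : ℕ} (ha : a < 2 ^ d) (hx : x < 2 ^ d) :
    a &&& (x + 2 ^ d) = 0 ↔ a &&& x = 0 := by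
  rw [Nat.and_comm, land_add_two_pow_iff hx ha, Nat.and_comm]

theorem land_add_two_pow_ne_zero {a d x : ℕ} (ha : a < 2 ^ d) (hx : x < 2 ^ d) :
    (a + 2 ^ d) &&& (x + 2 ^ d) ≠ 0 := by
  rw [add_two_pow_eq_lor ha, add_two_pow_eq_lor hx, Nat.and_or_distrib_right,
    Nat.and_or_distrib_left]
  simp [Nat.or_eq_zero_iff]

theorem lt_or_eq_add_two_pow {d x : ℕ} (hx : x < 2 ^ (d + 1)) :
    x < 2 ^ d ∨ ∃ x', x' < 2 ^ d ∧ x = x' + 2 ^ d := by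
  rw [pow_succ] at hx
  by_cases h : x < 2 ^ d
  · exact .inl h
  · exact .inr ⟨x - 2 ^ d, by omega, by omega⟩

/-- Powers of two below `2 ^ m` with total at least `2 ^ m` have a subfamily summing to `2 ^ m`,
which can be removed. -/
theorem exists_disjoint_sub_two_pow (x z m a b : ℕ) (ha : a < 2 ^ m) (hb : b < 2 ^ m)
    (hab : 2 ^ m ≤ a + b) (hx : a &&& x = 0) (hz : b &&& z = 0) :
    ∃ a' b', a' + b' + 2 ^ m = a + b ∧ a' &&& x = 0 ∧ b' &&& z = 0 := by
  induction m generalizing a b with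
  | zero => simp at *; omega
  | succ m ih =>
    rcases lt_or_eq_add_two_pow ha with ha' | ⟨a, ha', rfl⟩ <;>
    rcases lt_or_eq_add_two_pow hb with hb' | ⟨b, hb', rfl⟩ <;> rw [pow_succ] at *
    · omega
    · obtain ⟨a', b', h, h1, h2⟩ := ih a b ha' hb' (by omega) hx (land_add_two_pow hb' hz)
      exact ⟨a', b', by omega, h1, h2⟩
    · obtain ⟨a', b', h, h1, h2⟩ := ih a b ha' hb' (by omega) (land_add_two_pow ha' hx) hz
      exact ⟨a', b', by omega, h1, h2⟩
    · exact ⟨a, b, by omega, land_add_two_pow ha' hx, land_add_two_pow hb' hz⟩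

/-- `(a, b)` is a representation of `a + b` avoiding the bits of `(x, z)`. -/
def BitAvoid (x z a b : ℕ) : Prop := a &&& x = 0 ∧ b &&& z = 0

theorem BitAvoid.symm {x z a b : ℕ} (h : BitAvoid x z a b) : BitAvoid z x b a := ⟨h.2, h.1⟩

/-- The sum `a + b` has a representation avoiding the bits of `(x, z)` other than `(a, b)`. -/
def OtherAvoid (x z a b : ℕ) : Prop :=
  ∃ a' b', a' + b' = a + b ∧ a' ≠ a ∧ BitAvoid x z a' b'

/-- The sum `a + b + 2 ^ d` has a representation of width `d` avoiding the bits of `(x, z)`. -/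
def CarryAvoid (d x z a b : ℕ) : Prop :=
  ∃ a' b', a' + b' = a + b + 2 ^ d ∧ a' < 2 ^ d ∧ b' < 2 ^ d ∧ BitAvoid x z a' b'

theorem OtherAvoid.symm {x z a b : ℕ} : OtherAvoid x z a b → OtherAvoid z x b a :=
  fun ⟨a', b', h1, h2, h3⟩ => ⟨b', a', by omega, by omega, h3.symm⟩

theorem CarryAvoid.symm {d x z a b : ℕ} : CarryAvoid d x z a b → CarryAvoid d z x b a :=
  fun ⟨a', b', h1, h2, h3, h4⟩ => ⟨b', a', by omega, h3, h2, h4.symm⟩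

theorem otherAvoid_of_two_pow_le {d x z a b : ℕ} (hz : z < 2 ^ d) (ha : a < 2 ^ d)
    (hb : b < 2 ^ d) (hab : 2 ^ d ≤ a + b) (h : BitAvoid x z a b) : OtherAvoid x z a b := by
  obtain ⟨a', b', h1, h2, h3⟩ := exists_disjoint_sub_two_pow x z d a b ha hb hab h.1 h.2
  exact ⟨a', b' + 2 ^ d, by omega, by omega, h2, (land_add_two_pow_iff (by omega) hz).2 h3⟩

theorem otherAvoid_add_two_pow {d x z a b : ℕ} (hx : x < 2 ^ d) (hz : z < 2 ^ d)
    (hab : a + b < 2 ^ d) (h : OtherAvoid x z a b ∨ CarryAvoid d x z a b) :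
    OtherAvoid (x + 2 ^ d) z a (b + 2 ^ d) := by
  rcases h with ⟨a', b', h1, h2, h3, h4⟩ | ⟨a', b', h1, h2, h3, h4, h5⟩
  · exact ⟨a', b' + 2 ^ d, by omega, h2, (land_add_two_pow_iff' (by omega) hx).2 h3,
      (land_add_two_pow_iff (by omega) hz).2 h4⟩
  · exact ⟨a', b', by omega, by omega, (land_add_two_pow_iff' h2 hx).2 h4, h5⟩

theorem otherAvoid_swap {d x z a b : ℕ} (hx : x < 2 ^ d)
    (hab : a + b < 2 ^ d) (h : BitAvoid x z a (b + 2 ^ d)) :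
    OtherAvoid x z a (b + 2 ^ d) :=
  ⟨a + 2 ^ d, b, by omega, by have := Nat.two_pow_pos d; omega,
    (land_add_two_pow_iff (by omega) hx).2 h.1, land_add_two_pow (by omega) h.2⟩

theorem otherAvoid_or_carryAvoid {d x z a b : ℕ} (hs : x + z + 2 ≤ 2 ^ d)
    (hab : a + b < 2 ^ d) (h : BitAvoid x z a b) :
    OtherAvoid x z a b ∨ CarryAvoid d x z a b := by
  induction d generalizing x z a b with
  | zero => simp at hs
  | succ d ih =>
    have hpow : 2 ^ (d + 1) = 2 ^ d * 2 := pow_succ _ _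
    have key : ∀ {x z a b}, x < 2 ^ d → z < 2 ^ d → x + 2 ^ d + z + 2 ≤ 2 ^ (d + 1) →
        a + b < 2 ^ (d + 1) → BitAvoid (x + 2 ^ d) z a b →
        OtherAvoid (x + 2 ^ d) z a b ∨ CarryAvoid (d + 1) (x + 2 ^ d) z a b := by
      intro x z a b hx hz hs hab h
      have ha : a < 2 ^ d := by
        rcases lt_or_eq_add_two_pow (show a < 2 ^ (d + 1) by omega) with ha | ⟨a, ha, rfl⟩
        · exact ha
        · exact absurd h.1 (land_add_two_pow_ne_zero ha hx)
      have hax : a &&& x = 0 := (land_add_two_pow_iff' ha hx).1 h.1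
      rcases lt_or_eq_add_two_pow (show b < 2 ^ (d + 1) by omega) with hb | ⟨b, hb, rfl⟩
      · by_cases hlt : a + b < 2 ^ d
        · rcases ih (by omega) hlt ⟨hax, h.2⟩ with
            ⟨a', b', h1, h2, h3, h4⟩ | ⟨a', b', h1, h2, h3, h4, h5⟩
          · exact .inl ⟨a', b', h1, h2, (land_add_two_pow_iff' (by omega) hx).2 h3, h4⟩
          · exact .inr ⟨a', b' + 2 ^ d, by omega, by omega, by omega,
              (land_add_two_pow_iff' h2 hx).2 h4, (land_add_two_pow_iff h3 hz).2 h5⟩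
        · exact .inl (otherAvoid_of_two_pow_le hz ha hb (by omega) h)
      · exact .inl (otherAvoid_add_two_pow hx hz (by omega)
          (ih (by omega) (by omega) ⟨hax, land_add_two_pow hb h.2⟩))
    rcases lt_or_eq_add_two_pow (show x < 2 ^ (d + 1) by omega) with hx | ⟨x, hx, rfl⟩
    · rcases lt_or_eq_add_two_pow (show z < 2 ^ (d + 1) by omega) with hz | ⟨z, hz, rfl⟩
      · rcases lt_or_eq_add_two_pow (show a < 2 ^ (d + 1) by omega) with ha | ⟨a, ha, rfl⟩
        · rcases lt_or_eq_add_two_pow (show b < 2 ^ (d + 1) by omega) with hb | ⟨b, hb, rfl⟩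
          · exact .inr ⟨a + 2 ^ d, b + 2 ^ d, by omega, by omega, by omega,
              (land_add_two_pow_iff ha hx).2 h.1, (land_add_two_pow_iff hb hz).2 h.2⟩
          · exact .inl (otherAvoid_swap hx (by omega) h)
        · exact .inl (otherAvoid_swap hz (by omega) h.symm).symm
      · exact (key hz hx (by omega) (by omega) h.symm).imp (·.symm) (·.symm)
    · rcases lt_or_eq_add_two_pow (show z < 2 ^ (d + 1) by omega) with hz | ⟨z, hz, rfl⟩
      · exact key hx hz (by omega) (by omega) h
      · omega

/-- A number with exactly `k + 1` binary digits never has a unique representation avoiding the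
bits of `(x, z)` when `x + z < 2 ^ (k + 1) - 1`. -/
theorem otherAvoid_of_bitAvoid {k x z a b : ℕ} (hs : x + z + 2 ≤ 2 ^ (k + 1))
    (h1 : 2 ^ k ≤ a + b) (h2 : a + b < 2 ^ (k + 1)) (h : BitAvoid x z a b) :
    OtherAvoid x z a b := by
  have hpow : 2 ^ (k + 1) = 2 ^ k * 2 := pow_succ _ _
  have key : ∀ {x z a b}, x + z + 2 ≤ 2 ^ (k + 1) → b < 2 ^ k → a + b < 2 ^ k →
      BitAvoid x z a (b + 2 ^ k) → OtherAvoid x z a (b + 2 ^ k) := by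
    intro x z a b hs hb hab h
    have hz : z < 2 ^ k := by
      rcases lt_or_eq_add_two_pow (show z < 2 ^ (k + 1) by omega) with hz | ⟨z, hz, rfl⟩
      · exact hz
      · exact absurd h.2 (land_add_two_pow_ne_zero hb hz)
    rcases lt_or_eq_add_two_pow (show x < 2 ^ (k + 1) by omega) with hx | ⟨x, hx, rfl⟩
    · exact otherAvoid_swap hx hab h
    · exact otherAvoid_add_two_pow hx hz hab (otherAvoid_or_carryAvoid (by omega) hab
        ⟨(land_add_two_pow_iff' (by omega) hx).1 h.1, land_add_two_pow hb h.2⟩)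
  rcases lt_or_eq_add_two_pow (show a < 2 ^ (k + 1) by omega) with ha | ⟨a, ha, rfl⟩
  · rcases lt_or_eq_add_two_pow (show b < 2 ^ (k + 1) by omega) with hb | ⟨b, hb, rfl⟩
    · by_cases hz : z < 2 ^ k
      · exact otherAvoid_of_two_pow_le hz ha hb h1 h
      · exact (otherAvoid_of_two_pow_le (by omega) hb ha (by omega) h.symm).symm
    · exact key hs hb (by omega) h
  · exact (key (by omega) ha (by omega) h.symm).symm

/-- A zero digit of `x + z` below its top digit yields a second representation. -/
theorem disjoint_shift_of_testBit_eq_false (i x z : ℕ) (h : x &&& z = 0)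
    (hi : (x + z).testBit i = false) (hle : 2 ^ i ≤ x + z) :
    (2 ^ i ≤ z ∧ (z - 2 ^ i) &&& x = 0 ∧ (x + 2 ^ i) &&& z = 0) ∨
    (2 ^ i ≤ x ∧ (z + 2 ^ i) &&& x = 0 ∧ (x - 2 ^ i) &&& z = 0) := by
  induction i generalizing x z with
  | zero =>
    obtain ⟨a, p, hp, rfl⟩ : ∃ a p, p < 2 ∧ x = 2 * a + p := ⟨x / 2, x % 2, by omega, by omega⟩
    obtain ⟨b, q, hq, rfl⟩ : ∃ b q, q < 2 ∧ z = 2 * b + q := ⟨z / 2, z % 2, by omega, by omega⟩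
    obtain ⟨hab, hpq⟩ := (land_two_mul_add a b p q hp hq).1 h
    obtain ⟨rfl, rfl⟩ : p = 0 ∧ q = 0 := by
      rw [Nat.testBit_zero, decide_eq_false_iff_not] at hi
      rcases Nat.mul_eq_zero.1 hpq with rfl | rfl <;> omega
    have hz : ∀ a b, a &&& b = 0 → (2 * a + 1) &&& (2 * b) = 0 := fun a b h =>
      (land_two_mul_add a b 1 0 (by simp) (by simp)).2 ⟨h, rfl⟩
    rcases a with _ | a
    · rcases b with _ | b
      · simp at hle
      · left; simp; omega
    · rcases b with _ | b
      · right; simp; omega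
      · have hsucc := (land_succ_succ _ a b le_rfl).1 hab
        by_cases hl : (a + 1) &&& b = 0
        · exact .inl ⟨by omega, hz b (a + 1) (by rwa [Nat.and_comm]), hz _ _ hab⟩
        · have hr : a &&& (b + 1) = 0 := by tauto
          exact .inr ⟨by omega, hz (b + 1) (a + 1) (by rwa [Nat.and_comm]), hz _ _ hr⟩
  | succ i ih =>
    obtain ⟨a, p, hp, rfl⟩ : ∃ a p, p < 2 ∧ x = 2 * a + p := ⟨x / 2, x % 2, by omega, by omega⟩
    obtain ⟨b, q, hq, rfl⟩ : ∃ b q, q < 2 ∧ z = 2 * b + q := ⟨z / 2, z % 2, by omega, by omega⟩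
    obtain ⟨hab, hpq⟩ := (land_two_mul_add a b p q hp hq).1 h
    have hpq' : p + q < 2 := by rcases Nat.mul_eq_zero.1 hpq with rfl | rfl <;> omega
    have hdiv : (2 * a + p + (2 * b + q)) / 2 = a + b := by omega
    rw [Nat.testBit_succ, hdiv] at hi
    rw [pow_succ] at hle
    have hlift : ∀ a b p q, p < 2 → q < 2 → p * q = 0 → a &&& b = 0 →
        (2 * a + p) &&& (2 * b + q) = 0 := fun a b p q hp hq hpq h =>
      (land_two_mul_add a b p q hp hq).2 ⟨h, hpq⟩
    have hqp : q * p = 0 := by rwa [Nat.mul_comm]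
    have e1 : ∀ b q, 2 * b + q + 2 ^ (i + 1) = 2 * (b + 2 ^ i) + q := by
      intros; rw [pow_succ]; omega
    have e2 : ∀ b q, 2 ^ i ≤ b → 2 * b + q - 2 ^ (i + 1) = 2 * (b - 2 ^ i) + q := by
      intros; rw [pow_succ]; omega
    rcases ih a b hab hi (by omega) with ⟨h1, h2, h3⟩ | ⟨h1, h2, h3⟩
    · refine .inl ⟨by rw [pow_succ]; omega, ?_, ?_⟩
      · rw [e2 _ _ h1]; exact hlift _ _ _ _ hq hp hqp h2
      · rw [e1]; exact hlift _ _ _ _ hp hq hpq h3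
    · refine .inr ⟨by rw [pow_succ]; omega, ?_, ?_⟩
      · rw [e1]; exact hlift _ _ _ _ hq hp hqp h2
      · rw [e2 _ _ h1]; exact hlift _ _ _ _ hp hq hpq h3

theorem exists_two_testBit_eq_false {y : ℕ} (h : 2 ≤ y.bits.count false) :
    ∃ i j, i ≠ j ∧ 2 ^ i ≤ y ∧ 2 ^ j ≤ y ∧ y.testBit i = false ∧ y.testBit j = false := by
  rw [← List.duplicate_iff_two_le_count, List.duplicate_iff_exists_distinct_get] at h
  obtain ⟨i, j, hij, hi, hj⟩ := h
  refine ⟨i, j, by have := Fin.lt_def.1 hij; omega, ?_, ?_, ?_, ?_⟩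
  · rw [← Nat.lt_size, ← Nat.size_eq_bits_len]; exact i.2
  · rw [← Nat.lt_size, ← Nat.size_eq_bits_len]; exact j.2
  · rw [Nat.testBit_eq_inth, List.getI_eq_getElem _ i.2]; exact hi.symm
  · rw [Nat.testBit_eq_inth, List.getI_eq_getElem _ j.2]; exact hj.symm

/-- If `y = x + z` has two zero digits, then `(z, x)` is one of at least three representations. -/
theorem exists_bitAvoid_ne_ne {x z : ℕ} (hy : 2 ≤ (x + z).bits.count false) (h : x &&& z = 0)
    (a : ℕ) : ∃ a' b', a' + b' = x + z ∧ a' ≠ a ∧ a' ≠ z ∧ BitAvoid x z a' b' := by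
  have shift : ∀ i, (x + z).testBit i = false → 2 ^ i ≤ x + z →
      ∃ a' b', a' + b' = x + z ∧ (a' + 2 ^ i = z ∨ a' = z + 2 ^ i) ∧ BitAvoid x z a' b' := by
    intro i hi hle
    rcases disjoint_shift_of_testBit_eq_false i x z h hi hle with ⟨h1, h2, h3⟩ | ⟨h1, h2, h3⟩
    · exact ⟨z - 2 ^ i, x + 2 ^ i, by omega, by omega, h2, h3⟩
    · exact ⟨z + 2 ^ i, x - 2 ^ i, by omega, by omega, h2, h3⟩
  obtain ⟨i, j, hij, hi, hj, hi', hj'⟩ := exists_two_testBit_eq_false hy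
  obtain ⟨a₁, b₁, h1, h2, h3⟩ := shift i hi' hi
  obtain ⟨a₂, b₂, k1, k2, k3⟩ := shift j hj' hj
  have hpi := Nat.two_pow_pos i
  have hpj := Nat.two_pow_pos j
  have hne : 2 ^ i ≠ 2 ^ j := fun e => hij (Nat.pow_right_injective le_rfl e)
  by_cases ha : a₁ = a
  · exact ⟨a₂, b₂, k1, by omega, by omega, k3⟩
  · exact ⟨a₁, b₁, h1, ha, by omega, h3⟩

theorem append_eq_replicate_append_true {x : ℕ} {c : Bool} {s u v : List Bool} {b : Bool}
    (h : u ++ v = List.replicate x b ++ c :: s) :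
    (∃ i j, i + j = x ∧ u = List.replicate i b ∧ v = List.replicate j b ++ c :: s) ∨
    (∃ t, u = List.replicate x b ++ c :: t ∧ t ++ v = s) := by
  rcases List.append_eq_append_iff.1 h with ⟨t, h1, h2⟩ | ⟨t, h1, h2⟩
  · obtain ⟨h3, h4, h5⟩ := List.append_eq_replicate_iff.1 h1.symm
    exact .inl ⟨u.length, t.length, h3, h4, by rw [h2, ← h5]⟩
  · rcases t with _ | ⟨d, t⟩
    · exact .inl ⟨x, 0, rfl, by simpa using h1, by simpa using h2.symm⟩
    · simp only [List.cons_append, List.cons.injEq] at h2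
      obtain ⟨rfl, h2⟩ := h2
      exact .inr ⟨t, h1, h2.symm⟩

theorem wordTwo_eq (x y : ℕ) :
    wordTwo x y = List.replicate x false ++ true :: List.replicate y false := by
  simp [wordTwo]

theorem wordThree_eq (x y z : ℕ) :
    wordThree x y z = List.replicate x false ++ true :: wordTwo y z := by
  simp [wordThree, wordTwo]

theorem wordTwo_injective {x y x' y' : ℕ} (h : wordTwo x y = wordTwo x' y') :
    x = x' ∧ y = y' := by
  rw [wordTwo_eq, wordTwo_eq] at h
  rcases append_eq_replicate_append_true h with ⟨i, j, hij, h1, h2⟩ | ⟨t, h1, h2⟩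
  · have e1 := congrArg List.length h1
    have e2 := congrArg List.length h2
    rcases j with _ | j
    · simp at e1 e2; omega
    · simp [List.replicate_succ] at h2
  · have hmem : true ∈ List.replicate x false := by rw [h1]; simp
    simp at hmem

theorem append_eq_wordTwo {x y : ℕ} {u v : List Bool} (h : u ++ v = wordTwo x y) :
    (∃ i j, i + j = x ∧ u = List.replicate i false ∧ v = wordTwo j y) ∨
    (∃ i j, i + j = y ∧ u = wordTwo x i ∧ v = List.replicate j false) := by
  rw [wordTwo_eq] at h
  rcases append_eq_replicate_append_true h with ⟨i, j, hij, h1, h2⟩ | ⟨t, h1, h2⟩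
  · exact .inl ⟨i, j, hij, h1, by rw [h2, wordTwo_eq]⟩
  · obtain ⟨h3, h4, h5⟩ := List.append_eq_replicate_iff.1 h2
    exact .inr ⟨_, _, h3, by rw [h1, wordTwo_eq, ← h4], h5⟩

theorem append_eq_wordThree {x y z : ℕ} {u v : List Bool} (h : u ++ v = wordThree x y z) :
    (∃ i j, i + j = x ∧ u = List.replicate i false ∧ v = wordThree j y z) ∨
    (∃ i j, i + j = y ∧ u = wordTwo x i ∧ v = wordTwo j z) ∨
    (∃ i j, i + j = z ∧ u = wordThree x y i ∧ v = List.replicate j false) := by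
  rw [wordThree_eq] at h
  rcases append_eq_replicate_append_true h with ⟨i, j, hij, h1, h2⟩ | ⟨t, h1, h2⟩
  · exact .inl ⟨i, j, hij, h1, by rw [h2, wordThree_eq]⟩
  · rcases append_eq_wordTwo h2 with ⟨i, j, hij, h3, h4⟩ | ⟨i, j, hij, h3, h4⟩
    · exact .inr (.inl ⟨i, j, hij, by rw [h1, wordTwo_eq, ← h3], h4⟩)
    · exact .inr (.inr ⟨i, j, hij, by rw [h1, wordThree_eq, ← h3], h4⟩)

theorem wordTwo_append_wordTwo (x a b z : ℕ) :
    wordTwo x a ++ wordTwo b z = wordThree x (a + b) z := by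
  rw [wordThree, List.replicate_add]
  simp [wordTwo, -List.replicate_append_replicate]

/-- An admissible splitting of a word into two distinct Ulam words. -/
def IsUlamSplit (w : List Bool) (p : List Bool × List Bool) : Prop :=
  p.1 ≠ [] ∧ p.2 ≠ [] ∧ p.1 ≠ p.2 ∧ w = p.1 ++ p.2 ∧ IsUlam p.1 ∧ IsUlam p.2

theorem ulamAux_congr {n m : ℕ} {w : List Bool} (hn : w.length ≤ n) (hm : w.length ≤ m) :
    ulamAux n w ↔ ulamAux m w := by
  induction n generalizing m w with
  | zero =>
    obtain rfl : w = [] := List.length_eq_zero_iff.1 (by omega)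
    cases m with
    | zero => rfl
    | succ m =>
      simp only [ulamAux]
      simp +contextual [ExistsUnique]
  | succ n ih =>
    cases m with
    | zero =>
      obtain rfl : w = [] := List.length_eq_zero_iff.1 (by omega)
      simp only [ulamAux]
      simp +contextual [ExistsUnique]
    | succ m =>
      simp only [ulamAux]
      split_ifs with h
      · rfl
      · refine existsUnique_congr fun p => ?_
        refine and_congr_right fun h1 => and_congr_right fun h2 => and_congr_right fun _ =>
          and_congr_right fun h3 => ?_
        have hl := congrArg List.length h3
        rw [List.length_append] at hl
        have l1 := List.length_pos_iff.2 h1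
        have l2 := List.length_pos_iff.2 h2
        rw [ih (w := p.1) (m := m) (by omega) (by omega),
          ih (w := p.2) (m := m) (by omega) (by omega)]

theorem isUlam_iff {w : List Bool} (hw : w.length ≠ 1) :
    IsUlam w ↔ ∃! p, IsUlamSplit w p := by
  have h : IsUlam w ↔ ulamAux (w.length + 1) w := ulamAux_congr le_rfl (by omega)
  rw [h, ulamAux, if_neg hw]
  refine existsUnique_congr fun p => ?_
  refine and_congr_right fun h1 => and_congr_right fun h2 => and_congr_right fun _ =>
    and_congr_right fun h3 => ?_
  have hl := congrArg List.length h3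
  rw [List.length_append] at hl
  rw [IsUlam, IsUlam, ulamAux_congr (m := p.1.length) (by omega) le_rfl,
    ulamAux_congr (m := p.2.length) (by omega) le_rfl]

theorem isUlam_of_length_eq_one {w : List Bool} (hw : w.length = 1) : IsUlam w := by
  simp [IsUlam, hw, ulamAux]

theorem IsUlam.eq_one_of_replicate {n : ℕ} {b : Bool} (hn : n ≠ 0)
    (h : IsUlam (List.replicate n b)) : n = 1 := by
  induction n using Nat.strong_induction_on with
  | _ n ih =>
    by_contra h1
    obtain ⟨⟨u, v⟩, ⟨hu, hv, hne, huv, hUu, hUv⟩, -⟩ := (isUlam_iff (by simpa using h1)).1 h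
    obtain ⟨hl, hu', hv'⟩ := List.append_eq_replicate_iff.1 huv.symm
    dsimp only at *
    have l1 := List.length_pos_iff.2 hu
    have l2 := List.length_pos_iff.2 hv
    rw [hu'] at hUu
    rw [hv'] at hUv
    have e1 := ih _ (by omega) (by omega) hUu
    have e2 := ih _ (by omega) (by omega) hUv
    exact hne (by rw [hu', hv', e1, e2])

theorem isUlamSplit_wordTwo_iff {x y : ℕ} {p : List Bool × List Bool} :
    IsUlamSplit (wordTwo x y) p ↔
      (∃ x', x = x' + 1 ∧ p = ([false], wordTwo x' y) ∧ IsUlam (wordTwo x' y)) ∨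
      (∃ y', y = y' + 1 ∧ p = (wordTwo x y', [false]) ∧ IsUlam (wordTwo x y')) := by
  have hfalse : IsUlam [false] := isUlam_of_length_eq_one rfl
  have hmem : ∀ a b, wordTwo a b ≠ [false] := fun a b h => by
    have : true ∈ wordTwo a b := by simp [wordTwo]
    simp [h] at this
  constructor
  · obtain ⟨u, v⟩ := p
    rintro ⟨hu, hv, -, huv, hUu, hUv⟩
    dsimp only at *
    rcases append_eq_wordTwo huv.symm with ⟨i, j, rfl, rfl, rfl⟩ | ⟨i, j, rfl, rfl, rfl⟩
    · obtain rfl := hUu.eq_one_of_replicate (by rintro rfl; simp at hu)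
      exact .inl ⟨j, by omega, rfl, hUv⟩
    · obtain rfl := hUv.eq_one_of_replicate (by rintro rfl; simp at hv)
      exact .inr ⟨i, rfl, rfl, hUu⟩
  · rintro (⟨x', rfl, rfl, h⟩ | ⟨y', rfl, rfl, h⟩)
    · exact ⟨by simp, by simp [wordTwo], (hmem _ _).symm,
        by simp [wordTwo, List.replicate_succ], hfalse, h⟩
    · exact ⟨by simp [wordTwo], by simp, hmem _ _,
        by simp [wordTwo, List.replicate_succ'], h, hfalse⟩

/-- `0^x 1 0^y` is Ulam exactly when `x` and `y` have no common binary digit `1`. -/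
theorem isUlam_wordTwo_iff {x y : ℕ} : IsUlam (wordTwo x y) ↔ x &&& y = 0 := by
  induction hn : x + y generalizing x y with
  | zero =>
    obtain ⟨rfl, rfl⟩ : x = 0 ∧ y = 0 := by omega
    simpa using isUlam_of_length_eq_one (w := wordTwo 0 0) rfl
  | succ n ih =>
    rw [isUlam_iff (by simp [wordTwo]; omega)]
    simp only [isUlamSplit_wordTwo_iff]
    rcases x with _ | x
    · obtain rfl : y = n + 1 := by omega
      have h := (ih (x := 0) (y := n) (by omega)).2 (by simp)
      simp [h]
    · rcases y with _ | y
      · obtain rfl : x = n := by omega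
        have h := (ih (x := x) (y := 0) (by omega)).2 (by simp)
        simp [h]
      · have hx := ih (x := x) (y := y + 1) (by omega)
        have hy := ih (x := x + 1) (y := y) (by omega)
        have hne : ([false], wordTwo x (y + 1)) ≠ (wordTwo (x + 1) y, [false]) := fun h => by
          have := congrArg List.length (Prod.ext_iff.1 h).1
          simp [wordTwo] at this
          omega
        rw [land_succ_succ _ x y le_rfl, ← hx, ← hy]
        simp only [Nat.add_right_cancel_iff, exists_eq_left']
        by_cases h1 : IsUlam (wordTwo x (y + 1)) <;> by_cases h2 : IsUlam (wordTwo (x + 1) y)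
        · simp only [h1, h2, and_true, iff_self, not_true, iff_false]
          rintro ⟨p, -, hp⟩
          exact hne ((hp _ (.inl rfl)).trans (hp _ (.inr rfl)).symm)
        · simp [h1, h2]
        · simp [h1, h2]
        · simp [h1, h2, ExistsUnique]

theorem isUlamSplit_wordTwo_wordTwo {x z a b : ℕ} (h : BitAvoid x z a b)
    (hne : ¬ (x = b ∧ a = z)) :
    IsUlamSplit (wordThree x (a + b) z) (wordTwo x a, wordTwo b z) :=
  ⟨by simp [wordTwo], by simp [wordTwo], fun h => hne (wordTwo_injective h),
    (wordTwo_append_wordTwo x a b z).symm, isUlam_wordTwo_iff.2 (by rw [Nat.and_comm]; exact h.1),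
    isUlam_wordTwo_iff.2 h.2⟩

/-- if `y` is not Zumkeller, `2^k ≤ y < 2^(k+1)`, and
`(x,z) ∈ Ulam[y]`, then `x + z ≥ 2^(k+1) - 1`. -/
theorem ulamSet_sum_lower_bound (k y : ℕ) (h1 : 2 ^ k ≤ y) (h2 : y < 2 ^ (k + 1))
    (hzum : ¬ IsZumkeller y) (x z : ℕ) (h : (x, z) ∈ UlamSet y) :
    2 ^ (k + 1) - 1 ≤ x + z := by
  by_contra! hlt
  have hs : x + z + 2 ≤ 2 ^ (k + 1) := by omega
  clear hlt
  have hpos : 0 < y := lt_of_lt_of_le (Nat.two_pow_pos k) h1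
  have hcount : 2 ≤ y.bits.count false := by
    by_contra hc
    exact hzum ⟨hpos, by omega⟩
  replace h : IsUlam (wordThree x y z) := h
  induction hn : x + z using Nat.strong_induction_on generalizing x z with
  | _ n ih =>
    obtain ⟨⟨u, v⟩, ⟨hu, hv, hne, huv, hUu, hUv⟩, huniq⟩ :=
      (isUlam_iff (by simp [wordThree]; omega)).1 h
    dsimp only at *
    rcases append_eq_wordThree huv.symm with
      ⟨i, j, rfl, rfl, rfl⟩ | ⟨a, b, rfl, rfl, rfl⟩ | ⟨i, j, rfl, rfl, rfl⟩
    · have hi : i ≠ 0 := by rintro rfl; simp at hu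
      exact ih (j + z) (by omega) j z (by omega) hUv rfl
    · have hab : BitAvoid x z a b :=
        ⟨by rw [Nat.and_comm]; exact isUlam_wordTwo_iff.1 hUu, isUlam_wordTwo_iff.1 hUv⟩
      suffices ∃ a' b', a' + b' = a + b ∧ a' ≠ a ∧ ¬ (x = b' ∧ a' = z) ∧ BitAvoid x z a' b' by
        obtain ⟨a', b', hsum, ha', hne', hav⟩ := this
        have hsplit := isUlamSplit_wordTwo_wordTwo hav hne'
        rw [hsum] at hsplit
        have := congrArg (fun p => p.1.length) (huniq _ hsplit)
        simp [wordTwo] at this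
        omega
      by_cases hxz : x + z = a + b ∧ x &&& z = 0
      · rw [← hxz.1] at hcount
        obtain ⟨a', b', e1, e2, e3, e4⟩ := exists_bitAvoid_ne_ne hcount hxz.2 a
        exact ⟨a', b', by omega, e2, fun e => e3 e.2, e4⟩
      · obtain ⟨a', b', e1, e2, e3⟩ := otherAvoid_of_bitAvoid hs h1 h2 hab
        refine ⟨a', b', e1, e2, ?_, e3⟩
        rintro ⟨rfl, rfl⟩
        exact hxz ⟨by omega, e3.2⟩
    · have hj : j ≠ 0 := by rintro rfl; simp at hv
      exact ih (x + i) (by omega) x i (by omega) hUu rfl
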